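/- For every α, ν ∈ ℝ, there is no admissible quantization of V_α of type (i)′ with parameter ν; that is, there is no ℝ-linear map Q from V_α to linear operators D → D satisfying Q({f, g}) = i(Q(f)Q(g) − Q(g)Q(f)) for all f, g ∈ V_α, Q(1) = I, Q(f) symmetric for every f ∈ V_α, Q(ℓ)ψ = −iψ′ + νψ, Q(sin θ) = multiplication by sin θ, and Q(cos θ) = multiplication by cos θ. -/

import Mathlib

noncomputable section

open Complex

/-- Partial derivative in the first (angle) variable. -/
def pdTheta (f : ℝ × ℝ → ℝ) : ℝ × ℝ → ℝ := fun p => deriv (fun t => f (t, p.2)) p.1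

/-- Partial derivative in the second (momentum) variable. -/
def pdEll (f : ℝ × ℝ → ℝ) : ℝ × ℝ → ℝ := fun p => deriv (fun l => f (p.1, l)) p.2

/-- Poisson bracket `{f,g} = f_ℓ g_θ − f_θ g_ℓ`. -/
def pb (f g : ℝ × ℝ → ℝ) : ℝ × ℝ → ℝ :=
  fun p => pdEll f p * pdTheta g p - pdTheta f p * pdEll g p

/-- Spanning set for the polynomial algebra `P`. -/
def PGens : Set (ℝ × ℝ → ℝ) :=
  {h | ∃ r m : ℕ, h = (fun p : ℝ × ℝ => p.2 ^ r * Real.sin (m * p.1)) ∨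
       h = (fun p : ℝ × ℝ => p.2 ^ r * Real.cos (m * p.1))}

/-- The polynomial algebra `P`. -/
def P : Submodule ℝ (ℝ × ℝ → ℝ) := Submodule.span ℝ PGens

def fone : ℝ × ℝ → ℝ := fun _ => 1
def fell : ℝ × ℝ → ℝ := fun p => p.2
def fsin : ℝ × ℝ → ℝ := fun p => Real.sin p.1
def fcos : ℝ × ℝ → ℝ := fun p => Real.cos p.1

lemma fone_mem_P : fone ∈ P :=
  Submodule.subset_span ⟨0, 0, Or.inr (by funext p; simp [fone])⟩

lemma fell_mem_P : fell ∈ P :=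
  Submodule.subset_span ⟨1, 0, Or.inr (by funext p; simp [fell])⟩

lemma fsin_mem_P : fsin ∈ P :=
  Submodule.subset_span ⟨0, 1, Or.inl (by funext p; simp [fsin])⟩

lemma fcos_mem_P : fcos ∈ P :=
  Submodule.subset_span ⟨0, 1, Or.inr (by funext p; simp [fcos])⟩

/-- The domain `D = C^∞(S¹,ℂ)`: smooth `2π`-periodic functions. -/
def Dom : Submodule ℂ (ℝ → ℂ) where
  carrier := {ψ | ContDiff ℝ (⊤ : ℕ∞) ψ ∧ ∀ t, ψ (t + 2 * Real.pi) = ψ t}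
  add_mem' := by
    intro a b ha hb
    exact ⟨ha.1.add hb.1, fun t => by simp [Pi.add_apply, ha.2 t, hb.2 t]⟩
  zero_mem' := ⟨contDiff_const, fun t => rfl⟩
  smul_mem' := by
    intro c a ha
    exact ⟨ha.1.const_smul c, fun t => by simp [Pi.smul_apply, ha.2 t]⟩

/-- The `L²` inner product on `D`. -/
def ip (φ ψ : ℝ → ℂ) : ℂ := ∫ t in (0:ℝ)..(2 * Real.pi), (starRingEnd ℂ) (φ t) * ψ t

/-- Symmetric operator on `D`. -/
def SymmetricOp (A : Dom →ₗ[ℂ] Dom) : Prop :=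
  ∀ φ ψ : Dom, ip (A φ : ℝ → ℂ) (ψ : ℝ → ℂ) = ip (φ : ℝ → ℂ) (A ψ : ℝ → ℂ)

/-- An admissible quantization of type (i)′ with parameter ν of a Lie subalgebra
`O ⊆ P` containing the basic set. -/
structure IsQuant (O : Submodule ℝ (ℝ × ℝ → ℝ)) (ν : ℝ)
    (Q : O →ₗ[ℝ] (Dom →ₗ[ℂ] Dom)) : Prop where
  map_bracket : ∀ (f g : O) (h : pb f g ∈ O),
    Q ⟨pb f g, h⟩ = Complex.I • (Q f ∘ₗ Q g - Q g ∘ₗ Q f)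
  map_one : ∀ h : fone ∈ O, Q ⟨fone, h⟩ = LinearMap.id
  symm : ∀ f : O, SymmetricOp (Q f)
  map_ell : ∀ (h : fell ∈ O) (ψ : Dom) (t : ℝ),
    (Q ⟨fell, h⟩ ψ : ℝ → ℂ) t = -Complex.I * deriv (ψ : ℝ → ℂ) t + (ν : ℂ) * (ψ : ℝ → ℂ) t
  map_sin : ∀ (h : fsin ∈ O) (ψ : Dom) (t : ℝ),
    (Q ⟨fsin, h⟩ ψ : ℝ → ℂ) t = (Real.sin t : ℂ) * (ψ : ℝ → ℂ) t
  map_cos : ∀ (h : fcos ∈ O) (ψ : Dom) (t : ℝ),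
    (Q ⟨fcos, h⟩ ψ : ℝ → ℂ) t = (Real.cos t : ℂ) * (ψ : ℝ → ℂ) t

end
noncomputable section
/-- Partial θ-derivative of a complex-valued function. -/
def pdThetaC (f : ℝ × ℝ → ℂ) : ℝ × ℝ → ℂ := fun p => deriv (fun t => f (t, p.2)) p.1
/-- Partial ℓ-derivative of a complex-valued function. -/
def pdEllC (f : ℝ × ℝ → ℂ) : ℝ × ℝ → ℂ := fun p => deriv (fun l => f (p.1, l)) p.2
/-- Poisson bracket of complex-valued functions. -/
def pbC (f g : ℝ × ℝ → ℂ) : ℝ × ℝ → ℂ :=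
  fun p => pdEllC f p * pdThetaC g p - pdThetaC f p * pdEllC g p

/-- `e^r_m = ℓ^r e^{imθ}`. -/
def eC (r : ℕ) (m : ℤ) : ℝ × ℝ → ℂ :=
  fun p => (p.2 : ℂ) ^ r * Complex.exp (Complex.I * (m : ℂ) * (p.1 : ℂ))

/-- The complexification `P_ℂ` of `P`. -/
def PC : Submodule ℂ (ℝ × ℝ → ℂ) :=
  Submodule.span ℂ {h | ∃ (r : ℕ) (m : ℤ), h = eC r m}

/-- Closure under the Poisson bracket (complex case). -/
def IsLieSubC (S : Submodule ℂ (ℝ × ℝ → ℂ)) : Prop :=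
  ∀ f g : ℝ × ℝ → ℂ, f ∈ S → g ∈ S → pbC f g ∈ S

/-- The generators of `W_α`: `1, e^0_1, e^0_{−1}, e^1_0` and
`e^2_{2N+1} + 2α e^1_{2N+1}` for all `N ∈ ℤ`. -/
def WGens (α : ℝ) : Set (ℝ × ℝ → ℂ) :=
  {fun _ => 1, eC 0 1, eC 0 (-1), eC 1 0} ∪
    {h | ∃ N : ℤ, h = eC 2 (2 * N + 1) + (2 * α : ℂ) • eC 1 (2 * N + 1)}

/-- `W_α`: the smallest complex Lie subalgebra of `P_ℂ` containing the generators. -/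
def W (α : ℝ) : Submodule ℂ (ℝ × ℝ → ℂ) :=
  sInf {S | S ≤ PC ∧ WGens α ⊆ S ∧ IsLieSubC S}

/-- The complexification of a real-valued function. -/
def cplx (f : ℝ × ℝ → ℝ) : ℝ × ℝ → ℂ := fun p => (f p : ℂ)

/-- `V_α`: the real elements of `W_α`, a real Lie subalgebra of `P`. -/
def V (α : ℝ) : Submodule ℝ (ℝ × ℝ → ℝ) where
  carrier := {f | cplx f ∈ W α}
  add_mem' := by
    intro a b ha hb
    simp only [Set.mem_setOf_eq] at *
    have h : cplx (a + b) = cplx a + cplx b := by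
      funext p; simp [cplx]
    rw [h]; exact add_mem ha hb
  zero_mem' := by
    simp only [Set.mem_setOf_eq]
    have h : cplx (0 : ℝ × ℝ → ℝ) = 0 := by funext p; simp [cplx]
    rw [h]; exact zero_mem _
  smul_mem' := by
    intro c a ha
    simp only [Set.mem_setOf_eq] at *
    have h : cplx (c • a) = (c : ℂ) • cplx a := by
      funext p; simp [cplx]
    rw [h]; exact Submodule.smul_mem _ _ ha
end
noncomputable section
lemma mem_W_of_mem_WGens {α : ℝ} {f : ℝ × ℝ → ℂ} (hf : f ∈ WGens α) : f ∈ W α := by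
  rw [W, Submodule.mem_sInf]
  exact fun S hS => hS.2.1 hf

lemma fone_mem_V (α : ℝ) : fone ∈ V α := by
  show cplx fone ∈ W α
  have h : cplx fone = fun _ => (1 : ℂ) := by funext p; simp [cplx, fone]
  rw [h]
  exact mem_W_of_mem_WGens (Or.inl (by simp))

lemma fell_mem_V (α : ℝ) : fell ∈ V α := by
  show cplx fell ∈ W α
  have h : cplx fell = eC 1 0 := by
    funext p; simp [cplx, fell, eC]
  rw [h]
  exact mem_W_of_mem_WGens (Or.inl (by simp [WGens]))

lemma fsin_mem_V (α : ℝ) : fsin ∈ V α := by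
  show cplx fsin ∈ W α
  have h : cplx fsin = (Complex.I / 2) • eC 0 (-1) - (Complex.I / 2) • eC 0 1 := by
    funext p
    have h1 : Complex.I * (((1 : ℤ) : ℂ)) * (p.1 : ℂ) = (p.1 : ℂ) * Complex.I := by
      push_cast; ring
    have h2 : Complex.I * (((-1 : ℤ) : ℂ)) * (p.1 : ℂ) = -(p.1 : ℂ) * Complex.I := by
      push_cast; ring
    simp only [cplx, fsin, eC, Pi.sub_apply, Pi.smul_apply, smul_eq_mul, pow_zero, one_mul,
      h1, h2, Complex.ofReal_sin]
    rw [Complex.sin]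
    ring
  rw [h]
  exact sub_mem
    (Submodule.smul_mem _ _ (mem_W_of_mem_WGens (Or.inl (by simp [WGens]))))
    (Submodule.smul_mem _ _ (mem_W_of_mem_WGens (Or.inl (by simp [WGens]))))

lemma fcos_mem_V (α : ℝ) : fcos ∈ V α := by
  show cplx fcos ∈ W α
  have h : cplx fcos = ((1 : ℂ) / 2) • eC 0 1 + ((1 : ℂ) / 2) • eC 0 (-1) := by
    funext p
    have h1 : Complex.I * (((1 : ℤ) : ℂ)) * (p.1 : ℂ) = (p.1 : ℂ) * Complex.I := by
      push_cast; ring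
    have h2 : Complex.I * (((-1 : ℤ) : ℂ)) * (p.1 : ℂ) = -(p.1 : ℂ) * Complex.I := by
      push_cast; ring
    simp only [cplx, fcos, eC, Pi.add_apply, Pi.smul_apply, smul_eq_mul, pow_zero, one_mul,
      h1, h2, Complex.ofReal_cos]
    rw [Complex.cos]
    ring
  rw [h]
  exact add_mem
    (Submodule.smul_mem _ _ (mem_W_of_mem_WGens (Or.inl (by simp [WGens]))))
    (Submodule.smul_mem _ _ (mem_W_of_mem_WGens (Or.inl (by simp [WGens]))))
end
noncomputable section
open Complex

/-- Shifted monomials `(ℓ+α)^r e^{imθ}`. -/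
def eL (α : ℝ) (r : ℕ) (m : ℤ) : ℝ × ℝ → ℂ :=
  fun p => ((p.2 : ℂ) + α) ^ r * Complex.exp (Complex.I * (m : ℂ) * (p.1 : ℂ))

lemma W_lie (α : ℝ) : IsLieSubC (W α) := by
  intro f g hf hg
  rw [W, Submodule.mem_sInf] at *
  exact fun S hS => hS.2.2 f g (hf S hS) (hg S hS)

lemma hasTheta {f : ℝ × ℝ → ℝ} (hf : ContDiff ℝ (⊤ : ℕ∞) f) (p : ℝ × ℝ) :
    HasDerivAt (fun t => f (t, p.2)) (pdTheta f p) p.1 := by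
  have hd : Differentiable ℝ f := hf.differentiable (by simp)
  exact (DifferentiableAt.hasDerivAt (by
    have : Differentiable ℝ (fun t : ℝ => f (t, p.2)) := by fun_prop
    exact this p.1))

lemma hasEll {f : ℝ × ℝ → ℝ} (hf : ContDiff ℝ (⊤ : ℕ∞) f) (p : ℝ × ℝ) :
    HasDerivAt (fun l => f (p.1, l)) (pdEll f p) p.2 := by
  have hd : Differentiable ℝ f := hf.differentiable (by simp)
  exact (DifferentiableAt.hasDerivAt (by
    have : Differentiable ℝ (fun l : ℝ => f (p.1, l)) := by fun_prop
    exact this p.2))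

lemma pdTheta_smooth {f : ℝ × ℝ → ℝ} (hf : ContDiff ℝ (⊤ : ℕ∞) f) :
    ContDiff ℝ (⊤ : ℕ∞) (pdTheta f) := by
  have h : pdTheta f = fun p => fderiv ℝ f p (1, 0) := by
    funext p
    have hd : HasFDerivAt f (fderiv ℝ f p) (p.1, p.2) :=
      (hf.differentiable (by simp) p).hasFDerivAt
    have h2 : HasDerivAt (fun t : ℝ => (t, p.2)) ((1 : ℝ), (0 : ℝ)) p.1 :=
      (hasDerivAt_id p.1).prodMk (hasDerivAt_const _ _)
    exact (hasTheta hf p).unique (hd.comp_hasDerivAt p.1 h2)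
  rw [h]
  exact (hf.fderiv_right (m := (⊤ : ℕ∞)) (by simp)).clm_apply contDiff_const

lemma pdEll_smooth {f : ℝ × ℝ → ℝ} (hf : ContDiff ℝ (⊤ : ℕ∞) f) :
    ContDiff ℝ (⊤ : ℕ∞) (pdEll f) := by
  have h : pdEll f = fun p => fderiv ℝ f p (0, 1) := by
    funext p
    have hd : HasFDerivAt f (fderiv ℝ f p) (p.1, p.2) :=
      (hf.differentiable (by simp) p).hasFDerivAt
    have h2 : HasDerivAt (fun t : ℝ => (p.1, t)) ((0 : ℝ), (1 : ℝ)) p.2 :=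
      (hasDerivAt_const _ _).prodMk (hasDerivAt_id p.2)
    exact (hasEll hf p).unique (hd.comp_hasDerivAt p.2 h2)
  rw [h]
  exact (hf.fderiv_right (m := (⊤ : ℕ∞)) (by simp)).clm_apply contDiff_const

lemma pb_smooth {f g : ℝ × ℝ → ℝ} (hf : ContDiff ℝ (⊤ : ℕ∞) f) (hg : ContDiff ℝ (⊤ : ℕ∞) g) :
    ContDiff ℝ (⊤ : ℕ∞) (pb f g) :=
  ((pdEll_smooth hf).mul (pdTheta_smooth hg)).sub ((pdTheta_smooth hf).mul (pdEll_smooth hg))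

lemma pdThetaC_eq {f g : ℝ × ℝ → ℝ} (hf : ContDiff ℝ (⊤ : ℕ∞) f) (hg : ContDiff ℝ (⊤ : ℕ∞) g)
    (p : ℝ × ℝ) : pdThetaC (fun p => (f p : ℂ) + I * (g p : ℂ)) p
      = (pdTheta f p : ℂ) + I * (pdTheta g p : ℂ) :=
  ((hasTheta hf p).ofReal_comp.add ((hasTheta hg p).ofReal_comp.const_mul I)).deriv

lemma pdEllC_eq {f g : ℝ × ℝ → ℝ} (hf : ContDiff ℝ (⊤ : ℕ∞) f) (hg : ContDiff ℝ (⊤ : ℕ∞) g)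
    (p : ℝ × ℝ) : pdEllC (fun p => (f p : ℂ) + I * (g p : ℂ)) p
      = (pdEll f p : ℂ) + I * (pdEll g p : ℂ) :=
  ((hasEll hf p).ofReal_comp.add ((hasEll hg p).ofReal_comp.const_mul I)).deriv

lemma pb_mem_V {α : ℝ} {f g : ℝ × ℝ → ℝ} (hf : ContDiff ℝ (⊤ : ℕ∞) f)
    (hg : ContDiff ℝ (⊤ : ℕ∞) g) (hfV : f ∈ V α) (hgV : g ∈ V α) : pb f g ∈ V α := by
  have h := W_lie α _ _ hfV hgV
  show cplx (pb f g) ∈ W α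
  have e : cplx (pb f g) = pbC (cplx f) (cplx g) := by
    funext p
    have h1 : pdThetaC (cplx f) p = pdTheta f p := (hasTheta hf p).ofReal_comp.deriv
    have h2 : pdThetaC (cplx g) p = pdTheta g p := (hasTheta hg p).ofReal_comp.deriv
    have h3 : pdEllC (cplx f) p = pdEll f p := (hasEll hf p).ofReal_comp.deriv
    have h4 : pdEllC (cplx g) p = pdEll g p := (hasEll hg p).ofReal_comp.deriv
    simp [pbC, h1, h2, h3, h4, cplx, pb]
  rw [e]; exact h

/-- The complexified quantization, as a relation. -/
def IsT {α : ℝ} (Q : V α →ₗ[ℝ] (Dom →ₗ[ℂ] Dom)) (F : ℝ × ℝ → ℂ) (A : Dom →ₗ[ℂ] Dom) : Prop :=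
  ∃ f g : V α, ContDiff ℝ (⊤ : ℕ∞) (f : ℝ × ℝ → ℝ) ∧ ContDiff ℝ (⊤ : ℕ∞) (g : ℝ × ℝ → ℝ) ∧
    (F = fun p => ((f : ℝ × ℝ → ℝ) p : ℂ) + I * ((g : ℝ × ℝ → ℝ) p : ℂ)) ∧
    A = Q f + I • Q g

lemma smul_real_op (c : ℝ) (A : Dom →ₗ[ℂ] Dom) : c • A = (c : ℂ) • A := by
  ext; simp

section
variable {α : ℝ} {Q : V α →ₗ[ℝ] (Dom →ₗ[ℂ] Dom)}

lemma IsT.unique {F : ℝ × ℝ → ℂ} {A B : Dom →ₗ[ℂ] Dom} (hA : IsT Q F A) (hB : IsT Q F B) :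
    A = B := by
  obtain ⟨f, g, -, -, hF, rfl⟩ := hA
  obtain ⟨f', g', -, -, hF', rfl⟩ := hB
  have h1 : f = f' := by
    ext p
    have := congrArg Complex.re (congrFun (hF.symm.trans hF') p)
    simpa using this
  have h2 : g = g' := by
    ext p
    have := congrArg Complex.im (congrFun (hF.symm.trans hF') p)
    simpa using this
  rw [h1, h2]

lemma IsT.add {F G : ℝ × ℝ → ℂ} {A B : Dom →ₗ[ℂ] Dom} (hA : IsT Q F A) (hB : IsT Q G B) :
    IsT Q (F + G) (A + B) := by
  obtain ⟨f, g, hf, hg, rfl, rfl⟩ := hA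
  obtain ⟨f', g', hf', hg', rfl, rfl⟩ := hB
  refine ⟨f + f', g + g', hf.add hf', hg.add hg', ?_, ?_⟩
  · funext p; simp; ring
  · rw [map_add, map_add, smul_add]; abel

lemma IsT.smul {F : ℝ × ℝ → ℂ} {A : Dom →ₗ[ℂ] Dom} (c : ℂ) (hA : IsT Q F A) :
    IsT Q (c • F) (c • A) := by
  obtain ⟨f, g, hf, hg, rfl, rfl⟩ := hA
  refine ⟨c.re • f - c.im • g, c.re • g + c.im • f, 
    (hf.const_smul c.re).sub (hg.const_smul c.im), 
    (hg.const_smul c.re).add (hf.const_smul c.im), ?_, ?_⟩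
  · funext p
    simp
    linear_combination (c.im : ℂ) * ((g : ℝ × ℝ → ℝ) p : ℂ) * I_mul_I
      - (((f : ℝ × ℝ → ℝ) p : ℂ) + I * ((g : ℝ × ℝ → ℝ) p : ℂ)) * Complex.re_add_im c
  · conv_lhs => rw [← Complex.re_add_im c]
    rw [map_sub, map_add, map_smul, map_smul, map_smul, map_smul]
    simp only [smul_real_op]
    have := I_mul_I
    match_scalars <;> first | (linear_combination (c.im : ℂ) * this) | (linear_combination (0:ℂ) * this)

lemma IsT.bracket {ν : ℝ} (hQ : IsQuant (V α) ν Q) {F G : ℝ × ℝ → ℂ} {A B : Dom →ₗ[ℂ] Dom}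
    (hA : IsT Q F A) (hB : IsT Q G B) :
    IsT Q (pbC F G) (I • (A ∘ₗ B - B ∘ₗ A)) := by
  obtain ⟨f, g, hf, hg, rfl, rfl⟩ := hA
  obtain ⟨f', g', hf', hg', rfl, rfl⟩ := hB
  have m1 := pb_mem_V hf hf' f.2 f'.2
  have m2 := pb_mem_V hg hg' g.2 g'.2
  have m3 := pb_mem_V hf hg' f.2 g'.2
  have m4 := pb_mem_V hg hf' g.2 f'.2
  refine ⟨⟨_, m1⟩ - ⟨_, m2⟩, ⟨_, m3⟩ + ⟨_, m4⟩, (pb_smooth hf hf').sub (pb_smooth hg hg'),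
    (pb_smooth hf hg').add (pb_smooth hg hf'), ?_, ?_⟩
  · funext p
    simp only [pbC, pdThetaC_eq hf hg, pdThetaC_eq hf' hg', pdEllC_eq hf hg, pdEllC_eq hf' hg']
    simp [pb]
    have := I_mul_I
    linear_combination ((pdEll g p : ℂ) * pdTheta g' p - pdTheta g p * pdEll g' p) * this
  · rw [map_sub, map_add, hQ.map_bracket f f' m1, hQ.map_bracket g g' m2,
      hQ.map_bracket f g' m3, hQ.map_bracket g f' m4]
    simp only [LinearMap.add_comp, LinearMap.comp_add, LinearMap.smul_comp, LinearMap.comp_smul]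
    have := I_mul_I
    match_scalars <;> first | (linear_combination I * this) | (linear_combination -I * this) | (linear_combination (0:ℂ) * this)

end

lemma dth (α : ℝ) (r : ℕ) (m : ℤ) (p : ℝ × ℝ) : pdThetaC (eL α r m) p =
    ((p.2 : ℂ) + α) ^ r * (Complex.exp (I * m * p.1) * (I * m)) := by
  have h1 : HasDerivAt (fun t : ℝ => I * (m : ℂ) * (t : ℂ)) (I * m * 1) p.1 :=
    (hasDerivAt_id p.1).ofReal_comp.const_mul _
  have := (h1.cexp.const_mul (((p.2 : ℂ) + α) ^ r)).deriv
  rw [mul_one] at this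
  exact this

lemma del (α : ℝ) (r : ℕ) (m : ℤ) (p : ℝ × ℝ) : pdEllC (eL α r m) p =
    (r * ((p.2 : ℂ) + α) ^ (r - 1)) * Complex.exp (I * m * p.1) := by
  have h1 : HasDerivAt (fun t : ℝ => ((t : ℂ) + α)) 1 p.2 :=
    ((hasDerivAt_id p.2).ofReal_comp).add_const _
  have := ((h1.pow r).mul_const (Complex.exp (I * m * p.1))).deriv
  rw [mul_one] at this
  exact this

lemma pbC_eL (α : ℝ) (r s t : ℕ) (m n : ℤ) (h : r + s = t + 1) :
    pbC (eL α r m) (eL α s n) = (I * ((r : ℂ) * n - m * s)) • eL α t (m + n) := by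
  have key : ∀ (x : ℂ) (r s : ℕ), r + s = t + 1 → (r : ℂ) * x ^ (r - 1) * x ^ s = r * x ^ t := by
    intro x r s h
    rcases Nat.eq_zero_or_pos r with h0 | h0
    · simp [h0]
    · rw [mul_assoc, ← pow_add, show r - 1 + s = t by omega]
  funext p
  have k1 := key ((p.2 : ℂ) + α) r s h
  have k2 := key ((p.2 : ℂ) + α) s r (by omega)
  have ex : Complex.exp (I * ((m + n : ℤ) : ℂ) * p.1) =
      Complex.exp (I * m * p.1) * Complex.exp (I * n * p.1) := by
    rw [← Complex.exp_add]; congr 1; push_cast; ring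
  simp only [pbC, dth, del, Pi.smul_apply, smul_eq_mul, eL]
  rw [ex]
  linear_combination (Complex.exp (I * m * p.1) * Complex.exp (I * n * p.1)) * I * (n * k1 - m * k2)

/-- Fourier modes. -/
def mode (n : ℤ) : Dom := ⟨fun t => Complex.exp (I * (n : ℂ) * (t : ℂ)), by
  constructor
  · have : ContDiff ℝ (⊤ : ℕ∞) (fun t : ℝ => (t : ℂ)) := Complex.ofRealCLM.contDiff
    exact (contDiff_const.mul this).cexp
  · intro t
    have : I * (n : ℂ) * ((t + 2 * Real.pi : ℝ) : ℂ) = I * n * t + n * (2 * Real.pi * I) := by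
      push_cast; ring
    show Complex.exp (I * (n : ℂ) * ((t + 2 * Real.pi : ℝ) : ℂ)) = Complex.exp (I * n * t)
    rw [this, Complex.exp_add, Complex.exp_int_mul_two_pi_mul_I, mul_one]⟩

lemma mode_apply (n : ℤ) (t : ℝ) :
    (mode n : ℝ → ℂ) t = Complex.exp (I * (n : ℂ) * (t : ℂ)) := rfl

lemma mode_hasDeriv (n : ℤ) (t : ℝ) :
    HasDerivAt (mode n : ℝ → ℂ) (Complex.exp (I * (n : ℂ) * (t : ℂ)) * (I * n)) t := by
  have h1 : HasDerivAt (fun t : ℝ => I * (n : ℂ) * (t : ℂ)) (I * n * 1) t :=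
    (hasDerivAt_id t).ofReal_comp.const_mul _
  rw [mul_one] at h1
  exact h1.cexp

lemma mode_ode (k : ℤ) (φ : Dom)
    (h : ∀ t, deriv (φ : ℝ → ℂ) t = I * k * (φ : ℝ → ℂ) t) :
    φ = ((φ : ℝ → ℂ) 0) • mode k := by
  have hd : Differentiable ℝ (φ : ℝ → ℂ) := φ.2.1.differentiable (by simp)
  have H : ∀ t : ℝ, HasDerivAt (fun t => (φ : ℝ → ℂ) t * (mode (-k) : ℝ → ℂ) t) 0 t := by
    intro t
    have h1 := (hd t).hasDerivAt.mul (mode_hasDeriv (-k) t)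
    have e : deriv (φ : ℝ → ℂ) t * (mode (-k) : ℝ → ℂ) t + (φ : ℝ → ℂ) t *
        (Complex.exp (I * ((-k : ℤ) : ℂ) * (t : ℂ)) * (I * ((-k : ℤ) : ℂ))) = 0 := by
      rw [h t, mode_apply]; push_cast; ring
    rw [e] at h1
    exact h1
  have c := is_const_of_deriv_eq_zero (fun t => (H t).differentiableAt) (fun t => (H t).deriv)
  ext t
  have := c t 0
  simp only [mode_apply] at this
  simp only [Submodule.coe_smul, Pi.smul_apply, smul_eq_mul, mode_apply]
  have e : Complex.exp (I * ((-k : ℤ) : ℂ) * t) * Complex.exp (I * k * t) = 1 := by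
    rw [← Complex.exp_add, ← Complex.exp_zero]; congr 1; push_cast; ring
  simp at this e
  rw [← this, mul_assoc, e, mul_one]

lemma mode_cancel {n m : ℤ} (hnm : n = m) {a b : ℂ} (h : a • mode n = b • mode m) : a = b := by
  subst hnm
  have := congrFun (congrArg (fun x : Dom => (x : ℝ → ℂ)) h) 0
  simpa [mode_apply] using this

/-- The quadratic generators of `W α`. -/
def FG (α : ℝ) (N : ℤ) : ℝ × ℝ → ℂ := eC 2 (2 * N + 1) + (2 * α : ℂ) • eC 1 (2 * N + 1)

lemma FG_eq (α : ℝ) (N : ℤ) :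
    FG α N = eL α 2 (2 * N + 1) + (-(α : ℂ) ^ 2) • eL α 0 (2 * N + 1) := by
  funext p; simp [FG, eC, eL]; ring

lemma FG_bracket (α : ℝ) (N : ℤ) :
    pbC (FG α N) (eL α 0 1) = (2 * I) • eL α 1 (2 * (N + 1)) := by
  have hd : ∀ p, pdEllC (FG α N) p =
      (2 * ((p.2 : ℂ) + α)) * Complex.exp (I * ((2 * N + 1 : ℤ) : ℂ) * p.1) := by
    intro p
    have h1 : HasDerivAt (fun t : ℝ => (t : ℂ)) 1 p.2 := (hasDerivAt_id p.2).ofReal_comp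
    have h2 := (((h1.pow 2).mul_const (Complex.exp (I * ((2 * N + 1 : ℤ) : ℂ) * p.1))).add
      (((h1.pow 1).mul_const (Complex.exp (I * ((2 * N + 1 : ℤ) : ℂ) * p.1))).const_mul
        (2 * α : ℂ))).deriv
    refine Eq.trans h2 ?_
    simp; ring
  funext p
  have ex : Complex.exp (I * ((2 * (N + 1) : ℤ) : ℂ) * p.1) =
      Complex.exp (I * ((2 * N + 1 : ℤ) : ℂ) * p.1) * Complex.exp (I * ((1 : ℤ) : ℂ) * p.1) := by
    rw [← Complex.exp_add]; congr 1; push_cast; ring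
  simp only [pbC, dth, del, hd, Pi.smul_apply, smul_eq_mul, eL]
  rw [ex]
  push_cast
  ring

lemma exp_mode (m : ℤ) (t : ℝ) : Complex.exp (I * (m : ℂ) * (t : ℂ)) =
    (Real.cos (m * t) : ℂ) + I * (Real.sin (m * t) : ℂ) := by
  have : I * (m : ℂ) * (t : ℂ) = ((m * t : ℝ) : ℂ) * I := by push_cast; ring
  rw [this, Complex.exp_mul_I]; push_cast; ring

lemma FG_mem (α : ℝ) (N : ℤ) : FG α N ∈ W α := mem_W_of_mem_WGens (Or.inr ⟨N, rfl⟩)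

section
variable {α : ℝ} {Q : V α →ₗ[ℝ] (Dom →ₗ[ℂ] Dom)}

lemma FG_isT (N : ℤ) : ∃ A, IsT Q (FG α N) A := by
  let f : ℝ × ℝ → ℝ := fun p => (p.2 ^ 2 + 2 * α * p.2) * Real.cos ((2 * N + 1 : ℤ) * p.1)
  let g : ℝ × ℝ → ℝ := fun p => (p.2 ^ 2 + 2 * α * p.2) * Real.sin ((2 * N + 1 : ℤ) * p.1)
  have e1 : ∀ p, FG α N p = (f p : ℂ) + I * (g p : ℂ) := by
    intro p
    simp only [FG, eC, Pi.add_apply, Pi.smul_apply, smul_eq_mul, exp_mode, f, g]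
    push_cast; ring
  have e2 : ∀ p, FG α (-N - 1) p = (f p : ℂ) - I * (g p : ℂ) := by
    intro p
    have : ((2 * (-N - 1) + 1 : ℤ) : ℝ) * p.1 = -((2 * N + 1 : ℤ) * p.1) := by push_cast; ring
    simp only [FG, eC, Pi.add_apply, Pi.smul_apply, smul_eq_mul, exp_mode, f, g, this,
      Real.cos_neg, Real.sin_neg]
    push_cast; ring
  have hf : f ∈ V α := by
    show cplx f ∈ W α
    have : cplx f = (1 / 2 : ℂ) • FG α N + (1 / 2 : ℂ) • FG α (-N - 1) := by
      funext p
      simp only [cplx, Pi.add_apply, Pi.smul_apply, smul_eq_mul, e1, e2]; ring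
    rw [this]
    exact add_mem (Submodule.smul_mem _ _ (FG_mem _ _)) (Submodule.smul_mem _ _ (FG_mem _ _))
  have hg : g ∈ V α := by
    show cplx g ∈ W α
    have : cplx g = (-I / 2 : ℂ) • FG α N + (I / 2 : ℂ) • FG α (-N - 1) := by
      funext p
      simp only [cplx, Pi.add_apply, Pi.smul_apply, smul_eq_mul, e1, e2]
      linear_combination (g p : ℂ) * I_mul_I
    rw [this]
    exact add_mem (Submodule.smul_mem _ _ (FG_mem _ _)) (Submodule.smul_mem _ _ (FG_mem _ _))
  refine ⟨_, ⟨f, hf⟩, ⟨g, hg⟩, ?_, ?_, funext e1, rfl⟩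
  · simp only [f]; fun_prop
  · simp only [g]; fun_prop

lemma fsin_smooth : ContDiff ℝ (⊤ : ℕ∞) fsin := by unfold fsin; fun_prop
lemma fcos_smooth : ContDiff ℝ (⊤ : ℕ∞) fcos := by unfold fcos; fun_prop

lemma E1_isT {ν : ℝ} (hQ : IsQuant (V α) ν Q) :
    ∃ E, IsT Q (eL α 0 1) E ∧ ∀ n, E (mode n) = mode (n + 1) := by
  refine ⟨_, ⟨⟨fcos, fcos_mem_V α⟩, ⟨fsin, fsin_mem_V α⟩, fcos_smooth, fsin_smooth, ?_, rfl⟩, ?_⟩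
  · funext p; simp only [eL, exp_mode]; simp [fcos, fsin]
  · intro n
    ext t
    have h1 := hQ.map_cos (fcos_mem_V α) (mode n) t
    have h2 := hQ.map_sin (fsin_mem_V α) (mode n) t
    simp only [LinearMap.add_apply, LinearMap.smul_apply, Submodule.coe_add, Submodule.coe_smul,
      Pi.add_apply, Pi.smul_apply, smul_eq_mul, h1, h2]
    have h3 := exp_mode 1 t
    have h4 : Complex.exp (I * ((n + 1 : ℤ) : ℂ) * t) = Complex.exp (I * n * t) *
        Complex.exp (I * ((1 : ℤ) : ℂ) * t) := by
      rw [← Complex.exp_add]; congr 1; push_cast; ring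
    simp only [mode_apply]
    rw [h4, h3]; simp only [Int.cast_one, one_mul]; ring

lemma Em1_isT {ν : ℝ} (hQ : IsQuant (V α) ν Q) :
    ∃ E, IsT Q (eL α 0 (-1)) E ∧ ∀ n, E (mode n) = mode (n - 1) := by
  refine ⟨_, ⟨⟨fcos, fcos_mem_V α⟩, -⟨fsin, fsin_mem_V α⟩, fcos_smooth, fsin_smooth.neg, ?_, rfl⟩,
    ?_⟩
  · funext p; simp only [eL, exp_mode]; simp [fcos, fsin]
  · intro n
    ext t
    have h1 := hQ.map_cos (fcos_mem_V α) (mode n) t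
    have h2 := hQ.map_sin (fsin_mem_V α) (mode n) t
    simp only [map_neg, LinearMap.neg_apply, LinearMap.add_apply, LinearMap.smul_apply,
      Submodule.coe_add, Submodule.coe_smul, Submodule.coe_neg, Pi.neg_apply,
      Pi.add_apply, Pi.smul_apply, smul_eq_mul, h1, h2]
    have h3 := exp_mode (-1) t
    have h4 : Complex.exp (I * ((n - 1 : ℤ) : ℂ) * t) = Complex.exp (I * n * t) *
        Complex.exp (I * ((-1 : ℤ) : ℂ) * t) := by
      rw [← Complex.exp_add]; congr 1; push_cast; ring
    simp only [mode_apply]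
    rw [h4, h3]
    simp only [Int.cast_neg, Int.cast_one, neg_mul, one_mul, Real.cos_neg, Real.sin_neg]
    push_cast; ring

lemma P_isT {ν : ℝ} (hQ : IsQuant (V α) ν Q) :
    ∃ E, IsT Q (eL α 1 0) E ∧ ∀ (ψ : Dom) (t : ℝ), (E ψ : ℝ → ℂ) t =
      -I * deriv (ψ : ℝ → ℂ) t + ((ν : ℂ) + α) * (ψ : ℝ → ℂ) t := by
  refine ⟨_, ⟨⟨fell, fell_mem_V α⟩ + α • ⟨fone, fone_mem_V α⟩, 0, ?_, contDiff_const, ?_, rfl⟩, ?_⟩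
  · have : ContDiff ℝ (⊤ : ℕ∞) (fun p : ℝ × ℝ => p.2 + α * 1) := by fun_prop
    exact this
  · funext p; simp [eL, fell, fone]
  · intro ψ t
    have h1 := hQ.map_ell (fell_mem_V α) ψ t
    rw [map_add, map_smul, map_zero, hQ.map_one]
    simp [h1]; ring

lemma comm_rel {ν : ℝ} (hQ : IsQuant (V α) ν Q) {r s t : ℕ} {m n k : ℤ}
    {X Y Z : Dom →ₗ[ℂ] Dom} (hX : IsT Q (eL α r m) X) (hY : IsT Q (eL α s n) Y)
    (hZ : IsT Q (eL α t k) Z) (h : r + s = t + 1) (hk : k = m + n) (ψ : Dom) :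
    X (Y ψ) - Y (X ψ) = ((r : ℂ) * n - m * s) • Z ψ := by
  subst hk
  have h1 := hX.bracket hQ hY
  rw [pbC_eL α r s t m n h] at h1
  have h2 := h1.unique (hZ.smul _)
  have h3 := congrArg (fun A : Dom →ₗ[ℂ] Dom => (-I) • A ψ) h2
  simp only [LinearMap.smul_apply, LinearMap.sub_apply, LinearMap.comp_apply, smul_smul,
    ← mul_assoc] at h3
  simpa using h3

lemma weight {ν : ℝ} (hQ : IsQuant (V α) ν Q) {r : ℕ} {m : ℤ}
    {X : Dom →ₗ[ℂ] Dom} (hX : IsT Q (eL α r m) X) :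
    ∃ x : ℤ → ℂ, ∀ n, X (mode n) = x n • mode (n + m) := by
  obtain ⟨P, hP, hPf⟩ := P_isT hQ
  refine ⟨fun n => (X (mode n) : ℝ → ℂ) 0, fun n => mode_ode _ _ ?_⟩
  have hPm : P (mode n) = ((n : ℂ) + ν + α) • mode n := by
    ext t
    rw [hPf, (mode_hasDeriv n t).deriv]
    simp only [Submodule.coe_smul, Pi.smul_apply, smul_eq_mul, mode_apply]
    linear_combination (-(n : ℂ) * Complex.exp (I * n * t)) * I_mul_I
  intro t
  have h := comm_rel hQ hP hX hX (by omega) (by simp) (mode n)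
  rw [hPm, map_smul] at h
  have h2 := congrFun (congrArg (fun x : Dom => (x : ℝ → ℂ)) h) t
  simp only [Submodule.coe_sub, Submodule.coe_smul, Pi.sub_apply, Pi.smul_apply, smul_eq_mul,
    hPf] at h2
  push_cast at h2 ⊢
  linear_combination I * h2 - (deriv (X (mode n) : ℝ → ℂ) t) * (-I_mul_I)

end

lemma mode_sub (n : ℤ) (a b : ℂ) : a • mode n - b • mode n = (a - b) • mode n := by
  ext t
  simp only [Submodule.coe_sub, Submodule.coe_smul, Pi.sub_apply, Pi.smul_apply, smul_eq_mul]
  ring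

theorem no_quant (α ν : ℝ) (Q : V α →ₗ[ℝ] (Dom →ₗ[ℂ] Dom)) (hQ : IsQuant (V α) ν Q) : False := by
  obtain ⟨E1, hE1, hE1m⟩ := E1_isT hQ
  obtain ⟨D1, hD1, hD1m⟩ := Em1_isT hQ
  obtain ⟨P, hP, hPf⟩ := P_isT hQ
  have hPm : ∀ n : ℤ, P (mode n) = ((n : ℂ) + ν + α) • mode n := by
    intro n
    ext t
    rw [hPf, (mode_hasDeriv n t).deriv]
    simp only [Submodule.coe_smul, Pi.smul_apply, smul_eq_mul, mode_apply]
    linear_combination (-(n : ℂ) * Complex.exp (I * n * t)) * I_mul_I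
  have exA : ∀ k : ℤ, ∃ A, IsT Q (eL α 1 (2 * k)) A := by
    intro k
    obtain ⟨F, hF⟩ := FG_isT (Q := Q) (k - 1)
    have h := (hF.bracket hQ hE1).smul ((2 * I)⁻¹)
    rw [FG_bracket, smul_smul, inv_mul_cancel₀ (by simp), one_smul, sub_add_cancel] at h
    exact ⟨_, h⟩
  choose A hA using exA
  have exE : ∀ k : ℤ, ∃ A, IsT Q (eL α 0 (2 * k + 1)) A := by
    intro k
    have h := ((hA k).bracket hQ hE1).smul (I⁻¹)
    rw [pbC_eL α 1 0 0 _ _ rfl, smul_smul] at h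
    simp at h
    exact ⟨_, h⟩
  choose E hE using exE
  have exS : ∀ k : ℤ, ∃ A, IsT Q (eL α 2 (2 * k + 1)) A := by
    intro k
    obtain ⟨F, hF⟩ := FG_isT (Q := Q) k
    have h := hF.add ((hE k).smul ((α : ℂ) ^ 2))
    rw [FG_eq, add_assoc, ← add_smul, neg_add_cancel, zero_smul, add_zero] at h
    exact ⟨_, h⟩
  choose S hS using exS
  choose c hc using fun k => weight hQ (hE k)
  choose a ha using fun k => weight hQ (hA k)
  choose s hs using fun k => weight hQ (hS k)
  have a0 : ∀ n : ℤ, a 0 n = (n : ℂ) + ν + α := by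
    intro n
    have h : A 0 = P := (hA 0).unique hP
    have h1 := ha 0 n
    rw [h, hPm] at h1
    exact (mode_cancel (by simp) h1).symm
  have c0 : ∀ n : ℤ, c 0 n = 1 := by
    intro n
    have h : E 0 = E1 := (hE 0).unique hE1
    have h1 := hc 0 n
    rw [h, hE1m, ← one_smul ℂ (mode (n + 1))] at h1
    exact (mode_cancel (by simp) h1).symm
  have ra1 : ∀ k n : ℤ, a k (n + 1) - a k n = c k n := by
    intro k n
    have h := comm_rel hQ (hA k) hE1 (hE k) rfl rfl (mode n)
    rw [hE1m, ha, ha, map_smul, hE1m, hc, show n + 1 + 2 * k = n + (2 * k + 1) by ring,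
      show n + 2 * k + 1 = n + (2 * k + 1) by ring, mode_sub, smul_smul] at h
    have := mode_cancel rfl h
    simpa using this
  have ra2 : ∀ k n : ℤ, a k (n - 1) - a k n = - c (k - 1) n := by
    intro k n
    have h := comm_rel hQ (hA k) hD1 (hE (k - 1)) rfl (by ring) (mode n)
    rw [hD1m, ha, ha, map_smul, hD1m, hc, show n - 1 + 2 * k = n + (2 * (k - 1) + 1) by ring,
      show n + 2 * k - 1 = n + (2 * (k - 1) + 1) by ring, mode_sub, smul_smul] at h
    have := mode_cancel rfl h
    simpa using this
  have cc : ∀ k n : ℤ, c k n = c (k - 1) (n + 1) := by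
    intro k n
    have h1 := ra1 k n
    have h2 := ra2 k (n + 1)
    rw [add_sub_cancel_right] at h2
    linear_combination -h1 - h2
  have c1 : ∀ k n : ℤ, c k n = 1 := by
    intro k
    induction k using Int.induction_on with
    | zero => exact c0
    | succ i ih => intro n; rw [cc, add_sub_cancel_right]; exact ih _
    | pred i ih =>
      intro n
      have := cc (-(i : ℤ)) (n - 1)
      rw [sub_add_cancel] at this
      rw [← this]; exact ih _
  have as : ∀ k n : ℤ, a k (n + 1) = a k n + 1 := by
    intro k n
    have := ra1 k n
    rw [c1] at this
    linear_combination this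
  have rs1 : ∀ k n : ℤ, s k (n + 1) - s k n = 2 * a (k + 1) n := by
    intro k n
    have h := comm_rel hQ (hS k) hE1 (hA (k + 1)) rfl (by ring) (mode n)
    rw [hE1m, hs, hs, map_smul, hE1m, ha, show n + 1 + (2 * k + 1) = n + 2 * (k + 1) by ring,
      show n + (2 * k + 1) + 1 = n + 2 * (k + 1) by ring, mode_sub, smul_smul] at h
    have := mode_cancel rfl h
    simpa using this
  have rs2 : ∀ k n : ℤ, s k (n - 1) - s k n = - (2 * a k n) := by
    intro k n
    have h := comm_rel hQ (hS k) hD1 (hA k) rfl (by ring) (mode n)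
    rw [hD1m, hs, hs, map_smul, hD1m, ha, show n - 1 + (2 * k + 1) = n + 2 * k by ring,
      show n + (2 * k + 1) - 1 = n + 2 * k by ring, mode_sub, smul_smul] at h
    have := mode_cancel rfl h
    simpa using this
  have aa : ∀ k n : ℤ, a (k + 1) n = a k n + 1 := by
    intro k n
    have h1 := rs1 k n
    have h2 := rs2 k (n + 1)
    rw [add_sub_cancel_right, as] at h2
    linear_combination (-1 / 2) * h1 - (1 / 2) * h2
  have af : ∀ k n : ℤ, a k n = (n : ℂ) + ν + α + k := by
    intro k
    induction k using Int.induction_on with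
    | zero => intro n; rw [a0]; simp
    | succ i ih => intro n; rw [aa, ih]; push_cast; ring
    | pred i ih =>
      intro n
      have := aa (-(i : ℤ) - 1) n
      rw [sub_add_cancel, ih] at this
      push_cast at this ⊢
      linear_combination -this
  have sf : ∀ k n : ℤ, s k (n + 1) = s k n + 2 * ((n : ℂ) + ν + α + k + 1) := by
    intro k n
    have := rs1 k n
    rw [af] at this
    push_cast at this
    linear_combination this
  have R : ∀ j k : ℤ, s j (2 * k) * a k 0 - a k (2 * j + 1) * s j 0
      = (4 * k - 2 * j - 1) * s (j + k) 0 := by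
    intro j k
    have h := comm_rel hQ (hS j) (hA k) (hS (j + k)) rfl (by ring) (mode 0)
    rw [ha, hs, hs, map_smul, map_smul, hs, ha, smul_smul, smul_smul, smul_smul,
      show (0 : ℤ) + 2 * k + (2 * j + 1) = 2 * (j + k) + 1 by ring,
      show (0 : ℤ) + (2 * j + 1) + 2 * k = 2 * (j + k) + 1 by ring, mode_sub] at h
    have := mode_cancel (by ring) h
    simp only [zero_add] at this
    push_cast at this
    linear_combination this
  have s2 : ∀ j, s j 2 = s j 0 + 2 * (2 * (ν + α + j + 1) + 1) := by
    intro j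
    have h1 := sf j 0
    have h2 := sf j 1
    norm_num at h1 h2
    linear_combination h1 + h2
  have sm2 : ∀ j, s j (-2) = s j 0 - 2 * (2 * (ν + α + j + 1) - 3) := by
    intro j
    have h1 := sf j (-1)
    have h2 := sf j (-2)
    norm_num at h1 h2
    linear_combination -h1 - h2
  have sm4 : ∀ j, s j (-4) = s j 0 - 2 * (4 * (ν + α + j + 1) - 10) := by
    intro j
    have h1 := sf j (-1)
    have h2 := sf j (-2)
    have h3 := sf j (-3)
    have h4 := sf j (-4)
    norm_num at h1 h2 h3 h4
    linear_combination -h1 - h2 - h3 - h4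
  have q1 := R 0 1
  have q2 := R 1 (-1)
  have q3 := R (-1) 1
  have q4 := R 1 (-2)
  norm_num [af, s2, sm2, sm4] at q1 q2 q3 q4
  have : (1 : ℂ) = 0 := by
    first | (linear_combination (1/8) * (q4 - 11 * q3 - 7 * q2 + 6 * q1)) | (linear_combination (-1/8) * (q4 - 11 * q3 - 7 * q2 + 6 * q1))
  exact one_ne_zero this

end

noncomputable section
/-- No-go theorem for `V_α`: there is no admissible quantization of `V_α` of type (i)′,
for any `α` and any `ν`. -/
theorem stmt15 (α ν : ℝ) : ¬ ∃ Q : V α →ₗ[ℝ] (Dom →ₗ[ℂ] Dom), IsQuant (V α) ν Q := by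
  rintro ⟨Q, hQ⟩
  exact no_quant α ν Q hQ
end
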